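/- Let N ≥ 1 and let G = U(N) be the group of N×N complex unitary matrices with its compact group topology. The unital star-subalgebra of the algebra C(G; ℂ) of continuous complex-valued functions on G generated by the functions g ↦ Tr(g^k), k ≥ 1, is dense with respect to the supremum norm in the subalgebra of continuous class functions on G (the continuous functions F with F(g h g⁻¹) = F(h) for all g, h ∈ G). -/

import Mathlib

open Matrix

/-- The continuous function `g ↦ Tr(g^k)` on the unitary group `U(N)`. -/
noncomputable def tracePow (N k : ℕ) : C(Matrix.unitaryGroup (Fin N) ℂ, ℂ) :=
  ⟨fun g => ((g : Matrix (Fin N) (Fin N) ℂ) ^ k).trace,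
    Continuous.matrix_trace (continuous_subtype_val.pow k)⟩

/-- A version of the Stone–Weierstrass theorem without the assumption that points are separated:
a continuous function that is constant on the common level sets of a family `S` is a uniform limit
of elements of the star-subalgebra generated by `S`. -/
theorem ContinuousMap.mem_closure_starAlgebra_adjoin {X : Type*} [TopologicalSpace X]
    [CompactSpace X] (S : Set C(X, ℂ)) (F : C(X, ℂ))
    (hF : ∀ x y, (∀ f ∈ S, f x = f y) → F x = F y) :
    F ∈ closure ((StarAlgebra.adjoin ℂ S : StarSubalgebra ℂ C(X, ℂ)) : Set C(X, ℂ)) := by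
  let Φ : X → (S → ℂ) := fun x s => s.1 x
  have hΦ : Continuous Φ := continuous_pi fun s => s.1.continuous
  let π : C(X, Set.range Φ) := ⟨Set.rangeFactorization Φ, hΦ.subtype_mk _⟩
  have hπ : Topology.IsQuotientMap π :=
    π.continuous.isClosedMap.isQuotientMap π.continuous Set.rangeFactorization_surjective
  have : CompactSpace (Set.range Φ) := isCompact_iff_compactSpace.mp (isCompact_range hΦ)
  let f : C(Set.range Φ, ℂ) := hπ.lift F fun x y hxy =>
    hF x y fun s hs => congrFun (congrArg Subtype.val hxy) ⟨s, hs⟩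
  have hf : f.comp π = F := hπ.lift_comp F _
  let B : StarSubalgebra ℂ C(Set.range Φ, ℂ) :=
    (StarAlgebra.adjoin ℂ S).comap (ContinuousMap.compStarAlgHom' ℂ ℂ π)
  have hB : B.toSubalgebra.SeparatesPoints := by
    intro u v huv
    obtain ⟨s, hs⟩ := Function.ne_iff.mp (Subtype.coe_injective.ne huv)
    refine ⟨_, ⟨⟨fun w => w.1 s, (continuous_apply s).comp continuous_subtype_val⟩, ?_, rfl⟩, hs⟩
    exact StarAlgebra.subset_adjoin ℂ S s.2
  have hfB : f ∈ closure (B : Set C(Set.range Φ, ℂ)) := by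
    have := ContinuousMap.starSubalgebra_topologicalClosure_eq_top_of_separatesPoints B hB
    rw [← StarSubalgebra.topologicalClosure_coe, this]
    trivial
  rw [← hf]
  exact map_mem_closure (f := fun u : C(Set.range Φ, ℂ) => u.comp π)
    (ContinuousMap.continuous_precomp π) hfB fun _ h => h

theorem Matrix.unitaryGroup.compactSpace (n : Type*) [Fintype n] [DecidableEq n] :
    CompactSpace (Matrix.unitaryGroup n ℂ) := by
  have hc : IsCompact (Set.univ.pi fun _ : n => Set.univ.pi fun _ : n =>
      Metric.closedBall (0 : ℂ) 1) :=
    isCompact_univ_pi fun _ => isCompact_univ_pi fun _ => isCompact_closedBall _ _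
  refine isCompact_iff_compactSpace.mp
    (IsCompact.of_isClosed_subset (X := Matrix n n ℂ) hc ?_ fun U hU => ?_)
  · exact isClosed_unitary
  · exact fun i _ j _ => mem_closedBall_zero_iff.mpr (entry_norm_bound_of_unitary hU i j)

open scoped Matrix.Norms.L2Operator in
/-- Every unitary matrix is the exponential of `i` times a Hermitian matrix. -/
theorem Matrix.exists_isHermitian_exp_eq {n : Type*} [Fintype n] [DecidableEq n]
    (g : Matrix.unitaryGroup n ℂ) :
    ∃ H : Matrix n n ℂ, H.IsHermitian ∧
      NormedSpace.exp (Complex.I • H) = (g : Matrix n n ℂ) := by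
  have hg : IsStarNormal (g : Matrix n n ℂ) := inferInstance
  have hfin : (spectrum ℂ (g : Matrix n n ℂ)).Finite := Matrix.finite_spectrum _
  have hH := IsSelfAdjoint.cfc_arg (g : Matrix n n ℂ)
  refine ⟨_, hH, ?_⟩
  have hcont : ContinuousOn (Complex.ofReal ∘ Complex.arg) (spectrum ℂ (g : Matrix n n ℂ)) :=
    hfin.continuousOn _
  rw [← CFC.exp_eq_normedSpace_exp (𝕜 := ℂ), ← cfc_comp_smul Complex.I _ _,
    ← cfc_comp' _ _ (g : Matrix n n ℂ)]
  conv_rhs => rw [← cfc_id' ℂ (g : Matrix n n ℂ)]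
  refine cfc_congr fun z hz => ?_
  have hz1 : ‖z‖ = 1 := spectrum.norm_eq_one_of_unitary g.2 hz
  have := Complex.norm_mul_exp_arg_mul_I z
  rw [hz1] at this
  simpa [← Complex.exp_eq_exp_ℂ, mul_comm] using this

/-- Unitary matrices are unitarily diagonalizable. -/
theorem Matrix.unitaryGroup.exists_eq_mul_diagonal_mul {n : Type*} [Fintype n] [DecidableEq n]
    (g : Matrix.unitaryGroup n ℂ) :
    ∃ (U : Matrix.unitaryGroup n ℂ) (d : n → ℂ),
      (g : Matrix n n ℂ) = U * diagonal d * star (U : Matrix n n ℂ) := by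
  obtain ⟨H, hH, hg⟩ := Matrix.exists_isHermitian_exp_eq g
  refine ⟨hH.eigenvectorUnitary, NormedSpace.exp fun i => Complex.I * hH.eigenvalues i, ?_⟩
  have hinv : (hH.eigenvectorUnitary : Matrix n n ℂ)⁻¹ =
      star (hH.eigenvectorUnitary : Matrix n n ℂ) :=
    Matrix.inv_eq_left_inv (Unitary.coe_star_mul_self _)
  have hunit : IsUnit (hH.eigenvectorUnitary : Matrix n n ℂ) :=
    IsUnit.of_mul_eq_one _ (Unitary.coe_mul_star_self hH.eigenvectorUnitary)
  rw [← hg, ← Matrix.exp_diagonal, ← hinv, ← Matrix.exp_conj _ _ hunit, hinv]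
  congr 1
  conv_lhs => rw [hH.spectral_theorem, Unitary.conjStarAlgAut_apply]
  rw [← smul_mul_assoc, ← mul_smul_comm, ← Matrix.diagonal_smul]
  rfl

/-- Two finite families with the same power sums agree up to a permutation. -/
theorem exists_perm_of_sum_pow_eq {n K : Type*} [Fintype n] [Field K] [CharZero K] {a b : n → K}
    (h : ∀ k, 1 ≤ k → ∑ i, a i ^ k = ∑ i, b i ^ k) :
    ∃ σ : Equiv.Perm n, ∀ i, b (σ i) = a i := by
  classical
  have heval (p : Polynomial K) : ∑ i, p.eval (a i) = ∑ i, p.eval (b i) := by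
    simp_rw [Polynomial.eval_eq_sum_range]
    rw [Finset.sum_comm, Finset.sum_comm (s := Finset.univ)]
    refine Finset.sum_congr rfl fun k _ => ?_
    rw [← Finset.mul_sum, ← Finset.mul_sum]
    rcases Nat.eq_zero_or_pos k with rfl | hk
    · simp
    · rw [h k hk]
  have hcard (c : K) : Fintype.card {i // a i = c} = Fintype.card {i // b i = c} := by
    let s : Finset K := insert c (Finset.univ.image a ∪ Finset.univ.image b)
    let p := Lagrange.interpolate s id (Pi.single c (1 : K))
    have hp (x : K) (hx : x ∈ s) : p.eval x = if x = c then 1 else 0 := by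
      have := Lagrange.eval_interpolate_at_node (s := s) (v := id) (Pi.single c (1 : K))
        Function.injective_id.injOn hx
      rwa [Pi.single_apply] at this
    have := heval p
    rw [Finset.sum_congr rfl fun i _ => hp (a i) (by simp [s]),
      Finset.sum_congr rfl fun i _ => hp (b i) (by simp [s])] at this
    simpa [Fintype.card_subtype] using this
  let e (c : K) : {i // a i = c} ≃ {i // b i = c} := Fintype.equivOfCardEq (hcard c)
  refine ⟨(Equiv.sigmaFiberEquiv a).symm.trans
    ((Equiv.sigmaCongrRight e).trans (Equiv.sigmaFiberEquiv b)), fun i => ?_⟩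
  exact (e (a i) ⟨i, rfl⟩).2

theorem Matrix.trace_mul_diagonal_mul_star_pow {n : Type*} [Fintype n] [DecidableEq n]
    (U : Matrix.unitaryGroup n ℂ) (d : n → ℂ) (k : ℕ) :
    ((U * diagonal d * star (U : Matrix n n ℂ)) ^ k).trace = ∑ i, d i ^ k := by
  have := map_pow (Unitary.conjStarAlgAut ℂ (Matrix n n ℂ) U) (diagonal d) k
  rw [Unitary.conjStarAlgAut_apply, Unitary.conjStarAlgAut_apply] at this
  rw [← this, Matrix.trace_mul_comm, ← mul_assoc, Unitary.coe_star_mul_self, one_mul,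
    Matrix.diagonal_pow, Matrix.trace_diagonal]
  rfl

/-- Unitary matrices whose powers have the same traces are conjugate in the unitary group. -/
theorem Matrix.unitaryGroup.isConj_of_trace_pow_eq {n : Type*} [Fintype n] [DecidableEq n]
    {g h : Matrix.unitaryGroup n ℂ}
    (hgh : ∀ k, 1 ≤ k →
      ((g : Matrix n n ℂ) ^ k).trace = ((h : Matrix n n ℂ) ^ k).trace) :
    IsConj g h := by
  obtain ⟨U, a, hU⟩ := Matrix.unitaryGroup.exists_eq_mul_diagonal_mul g
  obtain ⟨V, b, hV⟩ := Matrix.unitaryGroup.exists_eq_mul_diagonal_mul h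
  simp_rw [hU, hV, Matrix.trace_mul_diagonal_mul_star_pow] at hgh
  obtain ⟨σ, hσ⟩ := exists_perm_of_sum_pow_eq hgh
  let W : Matrix n n ℂ := (V : Matrix n n ℂ).submatrix id σ
  have hWstar : star W = (star (V : Matrix n n ℂ)).submatrix σ id := rfl
  have hW : W ∈ Matrix.unitaryGroup n ℂ := by
    rw [Matrix.mem_unitaryGroup_iff, hWstar, Matrix.submatrix_mul_equiv,
      Matrix.submatrix_id_id]
    exact Unitary.coe_mul_star_self V
  have hh : (h : Matrix n n ℂ) = W * diagonal a * star W := by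
    have : diagonal a = (diagonal b).submatrix σ σ := by
      rw [Matrix.submatrix_diagonal_equiv]
      congr 1
      exact funext fun i => (hσ i).symm
    rw [hWstar, this, Matrix.submatrix_mul_equiv, Matrix.submatrix_mul_equiv,
      Matrix.submatrix_id_id, hV]
  refine isConj_iff.mpr ⟨⟨W, hW⟩ * U⁻¹, Subtype.ext ?_⟩
  have hUU : star (U : Matrix n n ℂ) * U = 1 := Unitary.coe_star_mul_self U
  have h1 : (((⟨W, hW⟩ * U⁻¹ * g * (⟨W, hW⟩ * U⁻¹)⁻¹ : Matrix.unitaryGroup n ℂ)) : Matrix n n ℂ) =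
      W * star (U : Matrix n n ℂ) * g * (U * star W) := by
    have : ((⟨W, hW⟩ * U⁻¹)⁻¹ : Matrix.unitaryGroup n ℂ) = U * ⟨W, hW⟩⁻¹ := by group
    rw [this]
    rfl
  rw [h1, hU, hh]
  calc W * star (U : Matrix n n ℂ) * (U * diagonal a * star (U : Matrix n n ℂ)) * (U * star W)
      = W * (star (U : Matrix n n ℂ) * U) * diagonal a * (star (U : Matrix n n ℂ) * U)
          * star W := by simp only [mul_assoc]
    _ = W * diagonal a * star W := by rw [hUU, mul_one, mul_one]

/-- The unital star-subalgebra of `C(U(N), ℂ)` generated by the trace-power functions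
`g ↦ Tr(g^k)`, `k ≥ 1`, is dense (with respect to the supremum norm, i.e. the topology of
`C(U(N), ℂ)`) in the continuous class functions on `U(N)`. -/
theorem tracePow_starSubalgebra_dense_in_class_functions (N : ℕ) (hN : 1 ≤ N)
    (F : C(Matrix.unitaryGroup (Fin N) ℂ, ℂ))
    (hF_class : ∀ g h : Matrix.unitaryGroup (Fin N) ℂ, F (g * h * g⁻¹) = F h) :
    F ∈ closure
      ((StarAlgebra.adjoin ℂ
        { f : C(Matrix.unitaryGroup (Fin N) ℂ, ℂ) | ∃ k : ℕ, 1 ≤ k ∧ f = tracePow N k } :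
          StarSubalgebra ℂ C(Matrix.unitaryGroup (Fin N) ℂ, ℂ)) : Set _) := by
  have := Matrix.unitaryGroup.compactSpace (Fin N)
  refine ContinuousMap.mem_closure_starAlgebra_adjoin _ F fun g h hgh => ?_
  obtain ⟨c, rfl⟩ := isConj_iff.mp (Matrix.unitaryGroup.isConj_of_trace_pow_eq (g := g) (h := h)
    fun k hk => hgh (tracePow N k) ⟨k, hk, rfl⟩)
  exact (hF_class c g).symm
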